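/- arXiv:1811.09284 — 3 statements merged into one kernel-verified Lean document; each statement's English description precedes it below -/
import Mathlib

section
/- Let E be a real normed vector space, let Δ > 0, and let L1, L2 : E → E be two operators such that (i) L1 is coercive: there exists α₁ > 0 with α₁‖U − V‖ ≤ ‖L1(U) − L1(V)‖ for all U, V ∈ E; (ii) L1 − L2 is Lipschitz with constant α₂Δ: there exists α₂ > 0 with ‖(L1(U) − L2(U)) − (L1(V) − L2(V))‖ ≤ α₂Δ‖U − V‖ for all U, V ∈ E. Assume there exists U* ∈ E with L2(U*) = 0, and let (U^(k))_{k≥0} be a sequence in E satisfying the Deferred Correction iteration L1(U^(k+1)) = L1(U^(k)) − L2(U^(k)) for all k ≥ 0. Then for every k ≥ 0, ‖U^(k) − U*‖ ≤ ((α₂/α₁)Δ)^k · ‖U^(0) − U*‖. -/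
/-- DeC convergence estimate: under coercivity of `L1` and Lipschitz continuity of
`L1 - L2` with constant `α₂ * Δ`, the DeC iterates satisfy the geometric error bound. -/
theorem dec_error_bound
    {E : Type*} [NormedAddCommGroup E] [NormedSpace ℝ E]
    (Δ : ℝ) (hΔ : 0 < Δ)
    (L1 L2 : E → E)
    (α₁ : ℝ) (hα₁ : 0 < α₁)
    (hcoercive : ∀ U V : E, α₁ * ‖U - V‖ ≤ ‖L1 U - L1 V‖)
    (α₂ : ℝ) (hα₂ : 0 < α₂)
    (hlip : ∀ U V : E, ‖(L1 U - L2 U) - (L1 V - L2 V)‖ ≤ α₂ * Δ * ‖U - V‖)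
    (Ustar : E) (hUstar : L2 Ustar = 0)
    (U : ℕ → E)
    (hiter : ∀ k : ℕ, L1 (U (k + 1)) = L1 (U k) - L2 (U k)) :
    ∀ k : ℕ, ‖U k - Ustar‖ ≤ ((α₂ / α₁) * Δ) ^ k * ‖U 0 - Ustar‖ := by
  intro k
  induction k with
  | zero => simp
  | succ k ih =>
    have h1 := hcoercive (U (k + 1)) Ustar
    have h2 := hlip (U k) Ustar
    rw [hUstar, sub_zero, ← hiter k] at h2
    have h3 : ‖U (k + 1) - Ustar‖ ≤ (α₂ / α₁ * Δ) * ‖U k - Ustar‖ := by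
      have h4 : (α₂ / α₁ * Δ) * ‖U k - Ustar‖ = (α₂ * Δ * ‖U k - Ustar‖) / α₁ := by ring
      rw [h4, le_div_iff₀ hα₁, mul_comm]
      exact h1.trans h2
    have h5 : 0 ≤ α₂ / α₁ * Δ := by positivity
    calc ‖U (k + 1) - Ustar‖ ≤ (α₂ / α₁ * Δ) * ‖U k - Ustar‖ := h3
      _ ≤ (α₂ / α₁ * Δ) * ((α₂ / α₁ * Δ) ^ k * ‖U 0 - Ustar‖) :=
        mul_le_mul_of_nonneg_left ih h5
      _ = (α₂ / α₁ * Δ) ^ (k + 1) * ‖U 0 - Ustar‖ := by ring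
end

section
/- Let E be a real normed vector space, Δ > 0, and L1, L2 : E → E operators such that L1 is coercive with constant α₁ > 0 (α₁‖U − V‖ ≤ ‖L1(U) − L1(V)‖ for all U, V) and L1 − L2 is Lipschitz with constant α₂Δ (‖(L1(U) − L2(U)) − (L1(V) − L2(V))‖ ≤ α₂Δ‖U − V‖ for all U, V). Let U* satisfy L2(U*) = 0. If V, W ∈ E satisfy one Deferred Correction step L1(W) = L1(V) − L2(V), then ‖W − U*‖ ≤ (α₂/α₁)Δ · ‖V − U*‖. -/
/-- One DeC step contracts the error: if `L1 W = L1 V - L2 V`, then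
`‖W - U*‖ ≤ (α₂/α₁) Δ ‖V - U*‖`. -/
theorem dec_one_step_contraction
    {E : Type*} [NormedAddCommGroup E] [NormedSpace ℝ E]
    (Δ : ℝ) (hΔ : 0 < Δ)
    (L1 L2 : E → E)
    (α₁ : ℝ) (hα₁ : 0 < α₁)
    (hcoercive : ∀ U V : E, α₁ * ‖U - V‖ ≤ ‖L1 U - L1 V‖)
    (α₂ : ℝ) (hα₂ : 0 < α₂)
    (hlip : ∀ U V : E, ‖(L1 U - L2 U) - (L1 V - L2 V)‖ ≤ α₂ * Δ * ‖U - V‖)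
    (Ustar : E) (hUstar : L2 Ustar = 0)
    (V W : E) (hstep : L1 W = L1 V - L2 V) :
    ‖W - Ustar‖ ≤ (α₂ / α₁) * Δ * ‖V - Ustar‖ := by
  have h1 := hcoercive W Ustar
  have h2 := hlip V Ustar
  rw [hUstar, sub_zero, ← hstep] at h2
  have h3 : (α₂ / α₁) * Δ * ‖V - Ustar‖ = (α₂ * Δ * ‖V - Ustar‖) / α₁ := by ring
  rw [h3, le_div_iff₀ hα₁, mul_comm]
  exact h1.trans h2
end

section
/- Let E be a real normed vector space, Δ > 0, and L1, L2 : E → E operators such that L1 is coercive with constant α₁ > 0 (α₁‖U − V‖ ≤ ‖L1(U) − L1(V)‖ for all U, V) and L1 − L2 is Lipschitz with constant α₂Δ (‖(L1(U) − L2(U)) − (L1(V) − L2(V))‖ ≤ α₂Δ‖U − V‖ for all U, V). Let U* satisfy L2(U*) = 0 and let (U^(k))_{k≥0} satisfy L1(U^(k+1)) = L1(U^(k)) − L2(U^(k)) for all k. If η := (α₂/α₁)Δ < 1, then the sequence U^(k) converges to U* as k → ∞. -/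
open Filter Topology

/-- DeC convergence: if `η = (α₂/α₁) Δ < 1`, the DeC iterates converge to the
solution `U*` of `L2 U* = 0`. -/
theorem dec_convergence
    {E : Type*} [NormedAddCommGroup E] [NormedSpace ℝ E]
    (Δ : ℝ) (hΔ : 0 < Δ)
    (L1 L2 : E → E)
    (α₁ : ℝ) (hα₁ : 0 < α₁)
    (hcoercive : ∀ U V : E, α₁ * ‖U - V‖ ≤ ‖L1 U - L1 V‖)
    (α₂ : ℝ) (hα₂ : 0 < α₂)
    (hlip : ∀ U V : E, ‖(L1 U - L2 U) - (L1 V - L2 V)‖ ≤ α₂ * Δ * ‖U - V‖)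
    (Ustar : E) (hUstar : L2 Ustar = 0)
    (U : ℕ → E)
    (hiter : ∀ k : ℕ, L1 (U (k + 1)) = L1 (U k) - L2 (U k))
    (hη : (α₂ / α₁) * Δ < 1) :
    Tendsto U atTop (𝓝 Ustar) := by
  have hη0 : 0 ≤ (α₂ / α₁) * Δ := by positivity
  have hstep : ∀ k, ‖U (k + 1) - Ustar‖ ≤ (α₂ / α₁) * Δ * ‖U k - Ustar‖ := by
    intro k
    have h1 := hcoercive (U (k + 1)) Ustar
    have h2 := hlip (U k) Ustar
    rw [hUstar, sub_zero, ← hiter k] at h2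
    have h3 : ‖U (k + 1) - Ustar‖ ≤ (α₂ * Δ * ‖U k - Ustar‖) / α₁ := by
      rw [le_div_iff₀ hα₁]
      linarith
    calc _ ≤ _ := h3
      _ = _ := by ring
  have hbound : ∀ k, ‖U k - Ustar‖ ≤ ((α₂ / α₁) * Δ) ^ k * ‖U 0 - Ustar‖ := by
    intro k
    induction k with
    | zero => simp
    | succ k ih =>
      calc _ ≤ _ := hstep k
        _ ≤ (α₂ / α₁) * Δ * (((α₂ / α₁) * Δ) ^ k * ‖U 0 - Ustar‖) :=
          mul_le_mul_of_nonneg_left ih hη0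
        _ = _ := by ring
  rw [tendsto_iff_norm_sub_tendsto_zero]
  refine squeeze_zero (fun k => norm_nonneg _) hbound ?_
  simpa using (tendsto_pow_atTop_nhds_zero_of_lt_one hη0 hη).mul_const ‖U 0 - Ustar‖
end
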